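/- arXiv:0809.2074 — 2 statements merged into one kernel-verified Lean document; each statement's English description precedes it below -/
import Mathlib

section
/- Let q ≥ 3 be an integer and let χ₀ denote the principal Dirichlet character modulo q. There exists an absolute constant C > 0 such that for every integer q ≥ 3, the sum of |L(1,χ)|⁴ over all non-principal Dirichlet characters χ modulo q satisfies ∑_{χ ≠ χ₀ (mod q)} |L(1,χ)|⁴ = φ(q) · ∑_{n=1, (n,q)=1}^{q} d(n)²/n² + E, where |E| ≤ C · (φ(q)/√q) · log⁴(q+2). -/
open scoped Classical

lemma aux_sqrt_le_totient (q : ℕ) (hq : 0 < q) : Real.sqrt q ≤ 2 * (q.totient : ℝ) := by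
  have h1 : q ≤ q.divisors.card * q.totient := by
    conv_lhs => rw [← Nat.sum_totient q]
    rw [← smul_eq_mul, ← Finset.sum_const]
    apply Finset.sum_le_sum
    intro d hd
    exact Nat.le_of_dvd (Nat.totient_pos.2 hq) (Nat.totient_dvd_of_dvd (Nat.dvd_of_mem_divisors hd))
  have h2 : q.divisors.card ≤ 2 * Nat.sqrt q := by
    have hsub : q.divisors ⊆ (Finset.Icc 1 (Nat.sqrt q)) ∪ (Finset.Icc 1 (Nat.sqrt q)).image (fun e => q / e) := by
      intro d hd
      have hdq := Nat.dvd_of_mem_divisors hd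
      obtain ⟨e, he⟩ := hdq
      have hd0 : 0 < d := Nat.pos_of_mem_divisors hd
      have he0 : 0 < e := by
        rcases Nat.eq_zero_or_pos e with h | h
        · subst h; omega
        · exact h
      simp only [Finset.mem_union, Finset.mem_Icc, Finset.mem_image]
      by_cases h : d ≤ Nat.sqrt q
      · left; exact ⟨hd0, h⟩
      · right
        refine ⟨e, ⟨he0, ?_⟩, ?_⟩
        · by_contra h'
          have h3 : (Nat.sqrt q + 1) * (Nat.sqrt q + 1) ≤ d * e := Nat.mul_le_mul (by omega) (by omega)
          have h4 := Nat.lt_succ_sqrt q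
          simp only [Nat.succ_eq_add_one] at h4
          omega
        · rw [he]; exact Nat.mul_div_cancel _ he0
    calc _ ≤ _ := Finset.card_le_card hsub
      _ ≤ _ := Finset.card_union_le _ _
      _ ≤ Nat.sqrt q + Nat.sqrt q := by
        gcongr
        · simp
        · exact Finset.card_image_le.trans (by simp)
      _ = _ := by ring
  have h3 : (q : ℝ) ≤ 2 * Real.sqrt q * q.totient := by
    have : (q : ℝ) ≤ (q.divisors.card : ℝ) * q.totient := by exact_mod_cast h1
    have h4 : (q.divisors.card : ℝ) ≤ 2 * (Nat.sqrt q : ℝ) := by exact_mod_cast h2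
    have h5 : (Nat.sqrt q : ℝ) ≤ Real.sqrt q := Real.nat_sqrt_le_real_sqrt
    refine this.trans ?_
    gcongr
    linarith
  have h6 : 0 < Real.sqrt q := Real.sqrt_pos.2 (by exact_mod_cast hq)
  have h7 : Real.sqrt q * Real.sqrt q = q := Real.mul_self_sqrt (by positivity)
  nlinarith

lemma aux_harm (N : ℕ) : ∑ n ∈ Finset.range N, (1 : ℝ) / n ≤ 1 + Real.log N := by
  have h := harmonic_le_one_add_log N
  refine le_trans ?_ h
  rw [harmonic]
  push_cast
  rcases N with _ | N
  · simp
  rw [Finset.sum_range_succ', Finset.sum_range_succ]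
  simp
  positivity

lemma aux_sum_zero (q : ℕ) [NeZero q] (χ : DirichletCharacter ℂ q) (hχ : χ ≠ 1) (k : ℕ) :
    ∑ r ∈ Finset.range q, χ ((k * q + r : ℕ) : ZMod q) = 0 := by
  rw [← MulChar.sum_eq_zero_of_ne_one hχ]
  refine Finset.sum_bij' (fun r _ => (r : ZMod q)) (fun a _ => a.val) ?_ ?_ ?_ ?_ ?_
  · simp
  · intro a _; simpa using ZMod.val_lt a
  · intro a ha; simp at ha ⊢; exact Nat.mod_eq_of_lt ha
  · simp
  · simp

/-- block estimate -/
lemma aux_block (q : ℕ) [NeZero q] (χ : DirichletCharacter ℂ q) (hχ : χ ≠ 1) (s : ℝ) (hs : 1 < s)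
    (k : ℕ) (hk : 0 < k) :
    ‖∑ r ∈ Finset.range q, χ ((k * q + r : ℕ) : ZMod q) * (((k * q + r : ℕ) : ℝ) ^ (-s) : ℝ)‖ ≤
      q * (((k * q : ℕ) : ℝ) ^ (-s) - (((k + 1) * q : ℕ) : ℝ) ^ (-s)) := by
  have hq : 0 < q := Nat.pos_of_ne_zero (NeZero.ne q)
  have h0 : ∑ r ∈ Finset.range q, χ ((k * q + r : ℕ) : ZMod q) * (((k * q + r : ℕ) : ℝ) ^ (-s) : ℝ)
      = ∑ r ∈ Finset.range q, χ ((k * q + r : ℕ) : ZMod q) *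
        (((((k * q + r : ℕ) : ℝ) ^ (-s) - ((k * q : ℕ) : ℝ) ^ (-s) : ℝ)) : ℂ) := by
    have := aux_sum_zero q χ hχ k
    simp only [Complex.ofReal_sub, mul_sub, Finset.sum_sub_distrib]
    rw [← Finset.sum_mul, this]; simp
  rw [h0]
  refine (norm_sum_le _ _).trans ?_
  have : ∀ r ∈ Finset.range q, ‖χ ((k * q + r : ℕ) : ZMod q) *
        (((((k * q + r : ℕ) : ℝ) ^ (-s) - ((k * q : ℕ) : ℝ) ^ (-s) : ℝ)) : ℂ)‖ ≤
        (((k * q : ℕ) : ℝ) ^ (-s) - (((k + 1) * q : ℕ) : ℝ) ^ (-s)) := by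
    intro r hr
    have hr' := Finset.mem_range.1 hr
    have hkq : 0 < k * q := Nat.mul_pos hk hq
    have hkq' : (0:ℝ) < ((k * q : ℕ) : ℝ) := by exact_mod_cast hkq
    have m1 : (((k * q + r : ℕ) : ℝ)) ^ (-s) ≤ ((k * q : ℕ) : ℝ) ^ (-s) :=
      Real.rpow_le_rpow_of_nonpos hkq' (by exact_mod_cast Nat.le_add_right _ _) (by linarith)
    have m2 : (((k + 1) * q : ℕ) : ℝ) ^ (-s) ≤ (((k * q + r : ℕ) : ℝ)) ^ (-s) :=
      Real.rpow_le_rpow_of_nonpos (by exact_mod_cast (by omega)) 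
        (by exact_mod_cast (by rw [add_mul]; omega)) (by linarith)
    rw [norm_mul, Complex.norm_real, Real.norm_eq_abs, abs_of_nonpos (by linarith)]
    have := χ.norm_le_one ((k * q + r : ℕ) : ZMod q)
    have h3 := mul_le_mul_of_nonneg_right this (show 0 ≤ -((((k * q + r : ℕ) : ℝ)) ^ (-s) - ((k * q : ℕ) : ℝ) ^ (-s)) by linarith)
    linarith
  refine (Finset.sum_le_sum this).trans ?_
  rw [Finset.sum_const, Finset.card_range, nsmul_eq_mul]

lemma aux_blocks (q : ℕ) [NeZero q] (χ : DirichletCharacter ℂ q) (hχ : χ ≠ 1) (s : ℝ) (hs : 1 < s)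
    (K : ℕ) (hK : 0 < K) (m : ℕ) :
    ‖∑ n ∈ Finset.range ((K + m) * q), χ (n : ZMod q) * (((n : ℕ) : ℝ) ^ (-s) : ℝ)
      - ∑ n ∈ Finset.range (K * q), χ (n : ZMod q) * (((n : ℕ) : ℝ) ^ (-s) : ℝ)‖ ≤
      q * (((K * q : ℕ) : ℝ) ^ (-s) - (((K + m) * q : ℕ) : ℝ) ^ (-s)) := by
  induction m with
  | zero => simp
  | succ m ih =>
    have hb := aux_block q χ hχ s hs (K + m) (by omega)
    have e : (K + (m + 1)) * q = (K + m) * q + q := by ring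
    have e' : (K + m + 1) * q = (K + m) * q + q := by ring
    rw [e, Finset.sum_range_add, add_sub_right_comm]
    rw [e'] at hb
    refine (norm_add_le _ _).trans ?_
    have := add_le_add ih hb
    refine this.trans (le_of_eq ?_)
    ring

lemma aux_tail (q : ℕ) [NeZero q] (χ : DirichletCharacter ℂ q) (hχ : χ ≠ 1) (s : ℝ) (hs : 1 < s) :
    ‖χ.LFunction s - ∑ n ∈ Finset.range (q * q), χ (n : ZMod q) * (((n : ℕ) : ℝ) ^ (-s) : ℝ)‖ ≤
      1 / q := by
  have hq : 0 < q := Nat.pos_of_ne_zero (NeZero.ne q)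
  have hq' : (0:ℝ) < q := by exact_mod_cast hq
  have hs' : 1 < (s : ℂ).re := by simpa using hs
  rw [χ.LFunction_eq_LSeries hs']
  have hsum : HasSum (fun n : ℕ => χ (n : ZMod q) * (((n : ℕ) : ℝ) ^ (-s) : ℝ)) (LSeries (fun n => χ n) s) := by
    have := (χ.LSeriesSummable_of_one_lt_re hs').LSeriesHasSum
    unfold LSeriesHasSum at this
    convert this using 2 with n
    rw [LSeries.term_def]
    split_ifs with h
    · subst h
      have : (0:ℝ) ^ (-s) = 0 := Real.zero_rpow (by linarith)
      simp [this]
    · rw [Complex.ofReal_cpow (by positivity)]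
      push_cast
      rw [Complex.cpow_neg]; rfl
  have ht := hsum.tendsto_sum_nat
  have hm : Filter.Tendsto (fun m : ℕ => (q + m) * q) Filter.atTop Filter.atTop := by
    apply Filter.tendsto_atTop_mono _ Filter.tendsto_id
    intro m; simp only [id]; nlinarith
  have ht' := ((ht.comp hm).sub_const (∑ n ∈ Finset.range (q * q), χ (n : ZMod q) * ((((n : ℕ) : ℝ) ^ (-s) : ℝ) : ℂ))).norm
  refine le_of_tendsto ht' (Filter.Eventually.of_forall fun m => ?_)
  refine (aux_blocks q χ hχ s hs q hq m).trans ?_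
  have h1 : ((q * q : ℕ) : ℝ) ^ (-s) ≤ ((q * q : ℕ) : ℝ) ^ (-1 : ℝ) :=
    Real.rpow_le_rpow_of_exponent_le (by exact_mod_cast Nat.mul_pos hq hq) (by linarith)
  have h2 : (0:ℝ) ≤ (((q + m) * q : ℕ) : ℝ) ^ (-s) := by positivity
  rw [Real.rpow_neg_one] at h1
  calc _ ≤ (q : ℝ) * ((q * q : ℕ) : ℝ)⁻¹ := by gcongr; linarith
    _ = _ := by push_cast; field_simp

lemma aux_tail_one (q : ℕ) [NeZero q] (χ : DirichletCharacter ℂ q) (hχ : χ ≠ 1) :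
    ‖χ.LFunction 1 - ∑ n ∈ Finset.range (q * q), χ (n : ZMod q) * ((1 / n : ℝ) : ℂ)‖ ≤
      1 / q := by
  have hc : ContinuousAt (fun s : ℝ => ‖χ.LFunction s - ∑ n ∈ Finset.range (q * q), χ (n : ZMod q) * ((((n : ℕ) : ℝ) ^ (-s) : ℝ) : ℂ)‖) 1 := by
    apply ContinuousAt.norm
    apply ContinuousAt.sub
    · exact ((DirichletCharacter.differentiable_LFunction hχ).continuous.comp Complex.continuous_ofReal).continuousAt
    · apply tendsto_finsetSum
      intro n _
      apply ContinuousAt.mul continuousAt_const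
      apply Complex.continuous_ofReal.continuousAt.comp
      rcases Nat.eq_zero_or_pos n with h | h
      · subst h
        have : (fun x : ℝ => ((0:ℕ):ℝ) ^ (-x)) =ᶠ[nhds 1] fun _ => 0 := by
          filter_upwards [eventually_ne_nhds (show (1:ℝ) ≠ 0 by norm_num)] with x hx
          simp only [Nat.cast_zero]
          exact Real.zero_rpow (by simpa using hx)
        exact continuousAt_const.congr this.symm
      · have hn : (n:ℝ) ≠ 0 := by positivity
        exact (Real.continuousAt_const_rpow hn).comp continuousAt_neg
  have h2 := le_of_tendsto (b := 1 / (q:ℝ)) (hc.tendsto.mono_left (nhdsWithin_le_nhds (s := Set.Ioi 1)))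
    (by filter_upwards [self_mem_nhdsWithin] with s hs using aux_tail q χ hχ s hs)
  simpa [Real.rpow_neg_one] using h2

/-- the index set of residues coprime to `q` below `q²` -/
noncomputable def auxA (q : ℕ) : Finset ℕ := (Finset.range (q * q)).filter (fun n => Nat.Coprime n q)

/-- pairs -/
noncomputable def auxX (q : ℕ) : Finset (ℕ × ℕ) := auxA q ×ˢ auxA q

/-- harmonic mass of the index set -/
noncomputable def auxH (q : ℕ) : ℝ := ∑ a ∈ auxA q, 1 / (a : ℝ)

/-- weight of a pair of pairs -/
noncomputable def auxW (q : ℕ) (p r : ℕ × ℕ) : ℝ :=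
  if ((p.1 * p.2 : ℕ) : ZMod q) = ((r.1 * r.2 : ℕ) : ZMod q) then
    1 / (p.1 : ℝ) * (1 / (p.2 : ℝ)) * (1 / (r.1 : ℝ) * (1 / (r.2 : ℝ))) else 0

/-- partial sum -/
noncomputable def auxS (q : ℕ) (χ : DirichletCharacter ℂ q) : ℂ :=
  ∑ a ∈ auxA q, χ (a : ZMod q) * ((1 / a : ℝ) : ℂ)

lemma auxS_eq (q : ℕ) (χ : DirichletCharacter ℂ q) :
    auxS q χ = ∑ n ∈ Finset.range (q * q), χ (n : ZMod q) * ((1 / n : ℝ) : ℂ) := by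
  unfold auxS auxA
  apply Finset.sum_filter_of_ne
  intro n _ h
  by_contra h'
  apply h
  rw [MulChar.map_nonunit, zero_mul]
  rwa [ZMod.isUnit_iff_coprime]

lemma auxH_le (q : ℕ) : auxH q ≤ 1 + Real.log ((q * q : ℕ) : ℝ) := by
  refine le_trans ?_ (aux_harm (q * q))
  unfold auxH auxA
  apply Finset.sum_le_sum_of_subset_of_nonneg (Finset.filter_subset _ _)
  intros; positivity

lemma auxH_nonneg (q : ℕ) : 0 ≤ auxH q := Finset.sum_nonneg fun _ _ => by positivity

lemma auxS_norm (q : ℕ) (χ : DirichletCharacter ℂ q) : ‖auxS q χ‖ ≤ auxH q := by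
  refine (norm_sum_le _ _).trans (Finset.sum_le_sum fun a _ => ?_)
  rw [norm_mul, Complex.norm_real, Real.norm_eq_abs, abs_of_nonneg (by positivity)]
  exact mul_le_of_le_one_left (by positivity) (χ.norm_le_one _)

lemma aux_orth (q : ℕ) [NeZero q] (a b : ZMod q) (ha : IsUnit a) :
    ∑ χ : DirichletCharacter ℂ q, (starRingEnd ℂ) (χ a) * χ b = if a = b then (q.totient : ℂ) else 0 := by
  rw [← DirichletCharacter.sum_char_inv_mul_char_eq ℂ ha b]
  refine Finset.sum_congr rfl fun χ _ => ?_
  congr 1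
  have h1 : χ a⁻¹ * χ a = 1 := by
    rw [← map_mul, ZMod.inv_mul_of_unit _ ha, map_one]
  have h2 : (starRingEnd ℂ) (χ a) * χ a = 1 := by
    have : ‖χ a‖ = 1 := by
      obtain ⟨u, rfl⟩ := ha
      exact χ.unit_norm_eq_one u
    rw [mul_comm, Complex.mul_conj, Complex.normSq_eq_norm_sq, this]; simp
  have h3 : χ a ≠ 0 := right_ne_zero_of_mul_eq_one h1
  exact mul_right_cancel₀ h3 (h2.trans h1.symm)

lemma aux_fourth (q : ℕ) [NeZero q] :
    ∑ χ : DirichletCharacter ℂ q, ‖auxS q χ‖ ^ 4 =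
      (q.totient : ℝ) * ∑ p ∈ auxX q, ∑ r ∈ auxX q, auxW q p r := by
  have hsq : ∀ χ : DirichletCharacter ℂ q, auxS q χ ^ 2 =
      ∑ p ∈ auxX q, χ ((p.1 * p.2 : ℕ) : ZMod q) * ((1 / (p.1 : ℝ) * (1 / (p.2 : ℝ)) : ℝ) : ℂ) := by
    intro χ
    unfold auxX
    rw [sq, auxS, Finset.sum_mul_sum, Finset.sum_product]
    refine Finset.sum_congr rfl fun a _ => Finset.sum_congr rfl fun b _ => ?_
    push_cast
    rw [map_mul]
    ring
  apply Complex.ofReal_injective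
  have h4 : ∀ χ : DirichletCharacter ℂ q, ((‖auxS q χ‖ ^ 4 : ℝ) : ℂ) =
      ∑ p ∈ auxX q, ∑ r ∈ auxX q,
        ((starRingEnd ℂ) (χ ((p.1 * p.2 : ℕ) : ZMod q)) * χ ((r.1 * r.2 : ℕ) : ZMod q)) *
        ((1 / (p.1 : ℝ) * (1 / (p.2 : ℝ)) * (1 / (r.1 : ℝ) * (1 / (r.2 : ℝ))) : ℝ) : ℂ) := by
    intro χ
    have : ((‖auxS q χ‖ ^ 4 : ℝ) : ℂ) = (starRingEnd ℂ) (auxS q χ ^ 2) * (auxS q χ ^ 2) := by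
      rw [mul_comm, Complex.mul_conj, Complex.normSq_eq_norm_sq, norm_pow]
      congr 1; ring
    rw [this, hsq, map_sum, Finset.sum_mul_sum]
    refine Finset.sum_congr rfl fun a _ => Finset.sum_congr rfl fun b _ => ?_
    rw [map_mul, Complex.conj_ofReal, Complex.ofReal_mul (_ * _)]
    ring
  rw [Complex.ofReal_sum, Finset.sum_congr rfl fun χ _ => h4 χ, Finset.sum_comm]
  push_cast
  rw [Finset.mul_sum]
  refine Finset.sum_congr rfl fun p hp => ?_
  rw [Finset.sum_comm, Finset.mul_sum]
  refine Finset.sum_congr rfl fun r hr => ?_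
  rw [← Finset.sum_mul]
  have hu : IsUnit ((p.1 * p.2 : ℕ) : ZMod q) := by
    rw [ZMod.isUnit_iff_coprime]
    simp only [auxX, auxA, Finset.mem_product, Finset.mem_filter] at hp
    exact Nat.Coprime.mul_left hp.1.2 hp.2.2
  have := aux_orth q ((p.1 * p.2 : ℕ) : ZMod q) ((r.1 * r.2 : ℕ) : ZMod q) hu
  push_cast at this
  rw [this]
  unfold auxW
  push_cast
  split_ifs <;> simp

/-- main terms: pairs with equal product at most `q` -/
lemma aux_main (q : ℕ) (hq : 3 ≤ q) :
    ∑ x ∈ (auxX q ×ˢ auxX q).filter (fun x => x.1.1 * x.1.2 = x.2.1 * x.2.2 ∧ x.1.1 * x.1.2 ≤ q),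
      auxW q x.1 x.2 =
    ∑ n ∈ (Finset.Icc 1 q).filter (fun n => Nat.Coprime n q),
              (n.divisors.card : ℝ) ^ 2 / (n : ℝ) ^ 2 := by
  have hA : ∀ a ∈ auxA q, 0 < a ∧ a.Coprime q := by
    intro a ha
    simp only [auxA, Finset.mem_filter] at ha
    refine ⟨?_, ha.2⟩
    rcases Nat.eq_zero_or_pos a with h | h
    · subst h; have := ha.2; simp at this; omega
    · exact h
  rw [← Finset.sum_fiberwise_of_maps_to (g := fun x : (ℕ × ℕ) × (ℕ × ℕ) => x.1.1 * x.1.2)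
    (t := (Finset.Icc 1 q).filter (fun n => Nat.Coprime n q))]
  · refine Finset.sum_congr rfl fun n hn => ?_
    simp only [Finset.mem_filter, Finset.mem_Icc] at hn
    obtain ⟨⟨hn1, hnq⟩, hnc⟩ := hn
    have hset : (((auxX q ×ˢ auxX q).filter (fun x => x.1.1 * x.1.2 = x.2.1 * x.2.2 ∧ x.1.1 * x.1.2 ≤ q)).filter
        (fun x => x.1.1 * x.1.2 = n)) = n.divisorsAntidiagonal ×ˢ n.divisorsAntidiagonal := by
      have key : ∀ a b : ℕ, a * b = n → a ∈ auxA q := by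
        intro a b h
        simp only [auxA, Finset.mem_filter, Finset.mem_range]
        have hd : a ∣ n := ⟨b, h.symm⟩
        have := Nat.le_of_dvd (by omega) hd
        refine ⟨by nlinarith, Nat.Coprime.coprime_dvd_left hd hnc⟩
      ext ⟨⟨a, b⟩, ⟨c, d⟩⟩
      simp only [auxX, Finset.mem_filter, Finset.mem_product, Nat.mem_divisorsAntidiagonal]
      constructor
      · rintro ⟨⟨_, h1, h2⟩, h3⟩
        exact ⟨⟨h3, by omega⟩, by omega, by omega⟩
      · rintro ⟨⟨h1, _⟩, h2, _⟩
        exact ⟨⟨⟨⟨key a b h1, key b a (by rw [mul_comm]; exact h1)⟩, key c d h2, key d c (by rw [mul_comm]; exact h2)⟩, by omega, by omega⟩, h1⟩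
    rw [hset]
    have hval : ∀ x ∈ n.divisorsAntidiagonal ×ˢ n.divisorsAntidiagonal, auxW q x.1 x.2 = 1 / (n:ℝ) ^ 2 := by
      rintro ⟨⟨a, b⟩, ⟨c, d⟩⟩ h
      simp only [Finset.mem_product, Nat.mem_divisorsAntidiagonal] at h
      obtain ⟨⟨h1, _⟩, h2, _⟩ := h
      unfold auxW
      simp only [h1, h2, if_true]
      have h1' : (a:ℝ) * b = n := by exact_mod_cast h1
      have h2' : (c:ℝ) * d = n := by exact_mod_cast h2
      rw [one_div_mul_one_div, one_div_mul_one_div, h1', h2', one_div_mul_one_div, sq]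
    rw [Finset.sum_congr rfl hval, Finset.sum_const, Finset.card_product, nsmul_eq_mul]
    have : n.divisorsAntidiagonal.card = n.divisors.card := by
      rw [← Nat.map_div_right_divisors, Finset.card_map]
    rw [this]; push_cast; ring
  · rintro ⟨⟨a, b⟩, ⟨c, d⟩⟩ h
    simp only [auxX, Finset.mem_filter, Finset.mem_product] at h
    obtain ⟨⟨⟨ha, hb⟩, _⟩, _, h2⟩ := h
    simp only [Finset.mem_filter, Finset.mem_Icc]
    exact ⟨⟨Nat.mul_pos (hA a ha).1 (hA b hb).1, h2⟩, Nat.Coprime.mul_left (hA a ha).2 (hA b hb).2⟩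

/-- indicator of large entries -/
noncomputable def auxU (q a : ℕ) : ℝ := if q < a ^ 2 then 1 else 0

lemma auxU_nonneg (q a : ℕ) : 0 ≤ auxU q a := by unfold auxU; split_ifs <;> norm_num

lemma auxW_nonneg (q : ℕ) (p r : ℕ × ℕ) : 0 ≤ auxW q p r := by
  unfold auxW; split_ifs <;> positivity

lemma aux_class (q : ℕ) (hq : 3 ≤ q) (t : ZMod q) :
    ∑ a ∈ (auxA q).filter (fun a : ℕ => (a : ZMod q) = t), 1 / (a : ℝ) * auxU q a ≤
      1 / Real.sqrt q + (1 + Real.log q) / q := by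
  have : NeZero q := ⟨by omega⟩
  have hq0 : (0:ℝ) < q := by positivity
  have hs : 0 < Real.sqrt q := Real.sqrt_pos.2 hq0
  -- compare with the sum over `k < q`
  have h1 : ∑ a ∈ (auxA q).filter (fun a : ℕ => (a : ZMod q) = t), 1 / (a : ℝ) * auxU q a ≤
      ∑ k ∈ Finset.range q, (if k = 0 then 1 / Real.sqrt q else 1 / (k:ℝ) * (1 / q)) := by
    have hinj : Set.InjOn (fun a : ℕ => a / q) ((auxA q).filter (fun a : ℕ => (a : ZMod q) = t) : Set ℕ) := by
      intro a ha b hb hab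
      simp only [Finset.coe_filter, Set.mem_ofPred_eq] at ha hb
      have : (a : ZMod q) = b := ha.2.trans hb.2.symm
      rw [ZMod.natCast_eq_natCast_iff'] at this
      simp only at hab
      rw [← Nat.div_add_mod a q, ← Nat.div_add_mod b q, hab, this]
    refine le_trans ?_ (Finset.sum_le_sum_of_subset_of_nonneg
      (s := ((auxA q).filter (fun a : ℕ => (a : ZMod q) = t)).image (fun a => a / q)) ?_ ?_)
    · rw [Finset.sum_image hinj]
      refine Finset.sum_le_sum fun a ha => ?_
      have hc : a.Coprime q := by
        simp only [auxA, Finset.mem_filter] at ha; exact ha.1.2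
      unfold auxU
      split_ifs with h1 h2 h2
      · rw [mul_one]
        apply one_div_le_one_div_of_le hs
        apply Real.sqrt_le_iff.2 ⟨by positivity, by exact_mod_cast h1.le⟩
      · rw [mul_one, one_div_mul_one_div]
        have : 0 < a / q := Nat.pos_of_ne_zero h2
        apply one_div_le_one_div_of_le
        · positivity
        · exact_mod_cast Nat.div_mul_le_self a q
      · rw [mul_zero]; positivity
      · rw [mul_zero]; positivity
    · intro k hk
      simp only [Finset.mem_image, Finset.mem_filter, auxA, Finset.mem_range] at hk ⊢
      obtain ⟨a, ha, rfl⟩ := hk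
      exact Nat.div_lt_of_lt_mul ha.1.1
    · intro k _ _
      split_ifs <;> positivity
  refine h1.trans ?_
  have h2 : ∀ k ∈ Finset.range q, (if k = 0 then 1 / Real.sqrt q else 1 / (k:ℝ) * (1 / q)) =
      (if k = 0 then 1 / Real.sqrt q else 0) + 1 / (k:ℝ) * (1 / q) := by
    intro k _
    split_ifs with h <;> simp [h]
  rw [Finset.sum_congr rfl h2, Finset.sum_add_distrib, ← Finset.sum_mul]
  have h3 : ∑ k ∈ Finset.range q, (if k = 0 then 1 / Real.sqrt q else 0) = 1 / Real.sqrt q := by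
    rw [Finset.sum_ite_eq' ]
    simp; omega
  rw [h3]
  have := aux_harm q
  have h4 : (1 + Real.log q) / q = (1 + Real.log q) * (1 / q) := by ring
  rw [h4]
  gcongr

lemma aux_big (q : ℕ) (hq : 3 ≤ q) :
    ∑ p ∈ auxX q, ∑ r ∈ auxX q, auxW q p r * auxU q p.1 ≤
      auxH q ^ 3 * (1 / Real.sqrt q + (1 + Real.log q) / q) := by
  set B := (1 / Real.sqrt q + (1 + Real.log q) / q) with hB
  rw [Finset.sum_comm]
  have hin : ∀ r ∈ auxX q, ∑ p ∈ auxX q, auxW q p r * auxU q p.1 ≤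
      (1 / (r.1 : ℝ) * (1 / (r.2 : ℝ))) * (auxH q * B) := by
    intro r _
    unfold auxX
    rw [Finset.sum_product_right]
    unfold auxH
    rw [Finset.sum_mul, Finset.mul_sum]
    refine Finset.sum_le_sum fun b hb => ?_
    have hbu : IsUnit (b : ZMod q) := by
      rw [ZMod.isUnit_iff_coprime]
      simp only [auxA, Finset.mem_filter] at hb
      exact hb.2
    have hcl := aux_class q hq (((r.1 * r.2 : ℕ) : ZMod q) * (b : ZMod q)⁻¹)
    rw [Finset.sum_filter] at hcl
    calc ∑ a ∈ auxA q, auxW q (a, b) r * auxU q a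
        = ∑ a ∈ auxA q, (1 / (r.1 : ℝ) * (1 / (r.2 : ℝ))) * (1 / (b:ℝ)) *
          (if (a : ZMod q) = ((r.1 * r.2 : ℕ) : ZMod q) * (b : ZMod q)⁻¹ then 1 / (a : ℝ) * auxU q a else 0) := by
          refine Finset.sum_congr rfl fun a _ => ?_
          have hiff : (((a * b : ℕ) : ZMod q) = ((r.1 * r.2 : ℕ) : ZMod q)) ↔
            (a : ZMod q) = ((r.1 * r.2 : ℕ) : ZMod q) * (b : ZMod q)⁻¹ := by
            constructor
            · intro h
              rw [← h, Nat.cast_mul, mul_assoc, ZMod.mul_inv_of_unit _ hbu, mul_one]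
            · intro h
              rw [Nat.cast_mul, h, mul_assoc, ZMod.inv_mul_of_unit _ hbu, mul_one]
          unfold auxW
          simp only [hiff]
          split_ifs
          · ring
          · simp
      _ ≤ (1 / (r.1 : ℝ) * (1 / (r.2 : ℝ))) * (1 / (b:ℝ)) * B := by
          rw [← Finset.mul_sum]
          gcongr
      _ = _ := by ring
  refine (Finset.sum_le_sum hin).trans (le_of_eq ?_)
  rw [← Finset.sum_mul]
  unfold auxX
  rw [Finset.sum_product]
  simp only []
  rw [← Finset.sum_mul_sum]
  unfold auxH
  ring

lemma auxW_symm (q : ℕ) (p r : ℕ × ℕ) : auxW q p r = auxW q r p := by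
  unfold auxW
  simp only [eq_comm (a := ((p.1 * p.2 : ℕ) : ZMod q))]
  split_ifs
  · ring
  · rfl

lemma auxW_swap (q : ℕ) (p r : ℕ × ℕ) : auxW q p.swap r = auxW q p r := by
  unfold auxW
  simp only [Prod.fst_swap, Prod.snd_swap, mul_comm p.2 p.1, mul_comm (1 / (p.2:ℝ))]

lemma aux_big2 (q : ℕ) (hq : 3 ≤ q) :
    ∑ p ∈ auxX q, ∑ r ∈ auxX q, auxW q p r * auxU q p.2 ≤
      auxH q ^ 3 * (1 / Real.sqrt q + (1 + Real.log q) / q) := by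
  refine le_trans (le_of_eq ?_) (aux_big q hq)
  refine Finset.sum_bij' (fun p _ => p.swap) (fun p _ => p.swap) ?_ ?_ ?_ ?_ ?_
  · intro p hp; simp only [auxX, Finset.mem_product] at hp ⊢; exact ⟨hp.2, hp.1⟩
  · intro p hp; simp only [auxX, Finset.mem_product] at hp ⊢; exact ⟨hp.2, hp.1⟩
  · simp
  · simp
  · intro p _
    refine Finset.sum_congr rfl fun r _ => ?_
    rw [auxW_swap]; rfl

lemma aux_rem (q : ℕ) (hq : 3 ≤ q) :
    |(∑ p ∈ auxX q, ∑ r ∈ auxX q, auxW q p r) -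
    ∑ n ∈ (Finset.Icc 1 q).filter (fun n => Nat.Coprime n q),
              (n.divisors.card : ℝ) ^ 2 / (n : ℝ) ^ 2| ≤
      4 * (auxH q ^ 3 * (1 / Real.sqrt q + (1 + Real.log q) / q)) := by
  rw [← aux_main q hq, ← Finset.sum_product', ← Finset.sum_filter_add_sum_filter_not (auxX q ×ˢ auxX q)
    (fun x => x.1.1 * x.1.2 = x.2.1 * x.2.2 ∧ x.1.1 * x.1.2 ≤ q), add_sub_cancel_left,
    abs_of_nonneg (Finset.sum_nonneg fun _ _ => auxW_nonneg _ _ _)]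
  have hpt : ∀ x ∈ auxX q ×ˢ auxX q, ¬ (x.1.1 * x.1.2 = x.2.1 * x.2.2 ∧ x.1.1 * x.1.2 ≤ q) →
      auxW q x.1 x.2 ≤ auxW q x.1 x.2 * (auxU q x.1.1 + auxU q x.1.2 + auxU q x.2.1 + auxU q x.2.2) := by
    rintro ⟨⟨a, b⟩, ⟨c, d⟩⟩ hmem hx
    simp only at hx ⊢
    by_cases hcong : ((a * b : ℕ) : ZMod q) = ((c * d : ℕ) : ZMod q)
    · apply le_mul_of_one_le_right (auxW_nonneg _ _ _)
      have hone : ∀ u v : ℕ, q < u * v → 1 ≤ auxU q u + auxU q v := by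
        intro u v huv
        have n1 := auxU_nonneg q u
        have n2 := auxU_nonneg q v
        rcases le_total u v with h | h
        · have : auxU q v = 1 := if_pos (by nlinarith)
          linarith
        · have : auxU q u = 1 := if_pos (by nlinarith)
          linarith
      have n1 := auxU_nonneg q a
      have n2 := auxU_nonneg q b
      have n3 := auxU_nonneg q c
      have n4 := auxU_nonneg q d
      by_cases hab : q < a * b
      · linarith [hone a b hab]
      by_cases hcd : q < c * d
      · linarith [hone c d hcd]
      exfalso
      have hA : ∀ a ∈ auxA q, 0 < a := by
        intro a ha
        simp only [auxA, Finset.mem_filter] at ha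
        rcases Nat.eq_zero_or_pos a with h | h
        · subst h; have := ha.2; simp at this; omega
        · exact h
      simp only [auxX, Finset.mem_product] at hmem
      have p1 : 0 < a * b := Nat.mul_pos (hA a hmem.1.1) (hA b hmem.1.2)
      have p2 : 0 < c * d := Nat.mul_pos (hA c hmem.2.1) (hA d hmem.2.2)
      generalize a * b = m at *
      generalize c * d = n at *
      have hmn : m ≠ n := by
        intro h; exact hx ⟨h, by omega⟩
      rw [ZMod.natCast_eq_natCast_iff, Nat.modEq_iff_dvd] at hcong
      have := Int.eq_zero_of_abs_lt_dvd hcong (by rw [abs_lt]; constructor <;> omega)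
      omega
    · have : auxW q (a, b) (c, d) = 0 := if_neg hcong
      rw [this]; simp
  have hle : ∑ x ∈ (auxX q ×ˢ auxX q).filter
      (fun x => ¬ (x.1.1 * x.1.2 = x.2.1 * x.2.2 ∧ x.1.1 * x.1.2 ≤ q)), auxW q x.1 x.2 ≤
      ∑ x ∈ auxX q ×ˢ auxX q,
        auxW q x.1 x.2 * (auxU q x.1.1 + auxU q x.1.2 + auxU q x.2.1 + auxU q x.2.2) := by
    refine le_trans (Finset.sum_le_sum fun x hx => ?_)
      (Finset.sum_le_sum_of_subset_of_nonneg (Finset.filter_subset _ _) fun x _ _ => ?_)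
    · rw [Finset.mem_filter] at hx
      exact hpt x hx.1 hx.2
    · have n1 := auxU_nonneg q x.1.1
      have n2 := auxU_nonneg q x.1.2
      have n3 := auxU_nonneg q x.2.1
      have n4 := auxU_nonneg q x.2.2
      exact mul_nonneg (auxW_nonneg _ _ _) (by linarith)
  refine hle.trans ?_
  rw [Finset.sum_product]
  simp only [mul_add, Finset.sum_add_distrib]
  have b1 := aux_big q hq
  have b2 := aux_big2 q hq
  have b3 : ∑ p ∈ auxX q, ∑ r ∈ auxX q, auxW q p r * auxU q r.1 ≤
      auxH q ^ 3 * (1 / Real.sqrt q + (1 + Real.log q) / q) := by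
    rw [Finset.sum_comm]
    simpa only [auxW_symm q _ _] using b1
  have b4 : ∑ p ∈ auxX q, ∑ r ∈ auxX q, auxW q p r * auxU q r.2 ≤
      auxH q ^ 3 * (1 / Real.sqrt q + (1 + Real.log q) / q) := by
    rw [Finset.sum_comm]
    simpa only [auxW_symm q _ _] using b2
  linarith

lemma aux_pow_four (x y h δ : ℝ) (hx : 0 ≤ x) (hy : 0 ≤ y) (hxh : x ≤ h) (hyh : y ≤ h)
    (hd : |x - y| ≤ δ) : |x ^ 4 - y ^ 4| ≤ δ * (4 * h ^ 3) := by
  have e : x ^ 4 - y ^ 4 = (x - y) * (x ^ 3 + x ^ 2 * y + x * y ^ 2 + y ^ 3) := by ring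
  have hh : 0 ≤ h := hx.trans hxh
  rw [e, abs_mul, abs_of_nonneg (a := x ^ 3 + x ^ 2 * y + x * y ^ 2 + y ^ 3) (by positivity)]
  have : x ^ 3 + x ^ 2 * y + x * y ^ 2 + y ^ 3 ≤ h ^ 3 + h ^ 2 * h + h * h ^ 2 + h ^ 3 := by gcongr
  calc _ ≤ δ * (h ^ 3 + h ^ 2 * h + h * h ^ 2 + h ^ 3) := by
        apply mul_le_mul hd this (by positivity) ((abs_nonneg _).trans hd)
    _ = _ := by ring

/-- There is an absolute constant `C > 0` such that for every integer `q ≥ 3`,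
`∑_{χ ≠ χ₀ (q)} |L(1,χ)|⁴ = φ(q) ∑_{n≤q, (n,q)=1} d(n)²/n² + E` with
`|E| ≤ C (φ(q)/√q) log⁴(q+2)`. -/
theorem sum_abs_LFunction_one_pow_four :
    ∃ C : ℝ, 0 < C ∧ ∀ q : ℕ, ∀ hq : 3 ≤ q,
      haveI : NeZero q := ⟨by omega⟩
      ∃ E : ℝ,
        (∑ χ ∈ Finset.univ.filter (fun χ : DirichletCharacter ℂ q => χ ≠ 1),
            ‖χ.LFunction 1‖ ^ 4) =
          (q.totient : ℝ) *
            (∑ n ∈ (Finset.Icc 1 q).filter (fun n => Nat.Coprime n q),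
              (n.divisors.card : ℝ) ^ 2 / (n : ℝ) ^ 2) + E ∧
        |E| ≤ C * ((q.totient : ℝ) / Real.sqrt q) * Real.log (q + 2) ^ 4 := by
  refine ⟨10000, by norm_num, ?_⟩
  intro q hq
  have hNZ : NeZero q := ⟨by omega⟩
  refine ⟨_, (add_sub_cancel _ _).symm, ?_⟩
  set M := ∑ n ∈ (Finset.Icc 1 q).filter (fun n => Nat.Coprime n q),
              (n.divisors.card : ℝ) ^ 2 / (n : ℝ) ^ 2 with hM
  set ℓ := Real.log ((q:ℝ) + 2) with hℓ
  set F : ℝ := (q.totient : ℝ) with hF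
  set s := Real.sqrt q with hs
  set H := auxH q with hH
  have hq3 : (3:ℝ) ≤ q := by exact_mod_cast hq
  have hq0 : (0:ℝ) < q := by linarith
  have hs0 : 0 < s := Real.sqrt_pos.2 hq0
  have hss : s * s = q := Real.mul_self_sqrt hq0.le
  have hs1 : 1 ≤ s := by nlinarith
  have hF0 : 0 ≤ F := by positivity
  have hℓ1 : 1 ≤ ℓ := by
    rw [hℓ, Real.le_log_iff_exp_le (by linarith)]
    linarith [Real.exp_one_lt_d9]
  have hlog : Real.log q ≤ ℓ := Real.log_le_log hq0 (by linarith)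
  have hlog0 : 0 ≤ Real.log q := Real.log_nonneg (by linarith)
  have hH0 : 0 ≤ H := auxH_nonneg q
  have hH3 : H ≤ 3 * ℓ := by
    have := auxH_le q
    rw [Nat.cast_mul, Real.log_mul hq0.ne' hq0.ne'] at this
    linarith
  have hsF : 1 ≤ 2 * (F / s) := by
    have := aux_sqrt_le_totient q (by omega)
    rw [← mul_div_assoc, le_div_iff₀ hs0]; linarith
  have hinv : 1 / (q:ℝ) ≤ 1 / s := by
    apply one_div_le_one_div_of_le hs0; nlinarith
  -- truncation error
  have hL : ∀ χ : DirichletCharacter ℂ q, χ ≠ 1 →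
      |‖χ.LFunction 1‖ ^ 4 - ‖auxS q χ‖ ^ 4| ≤ 1 / q * (4 * (4 * ℓ) ^ 3) := by
    intro χ hχ
    have ht := aux_tail_one q χ hχ
    rw [← auxS_eq] at ht
    have hn := auxS_norm q χ
    have hab := (abs_norm_sub_norm_le (χ.LFunction 1) (auxS q χ)).trans ht
    have h1 : 1 / (q:ℝ) ≤ 1 := by rw [div_le_one hq0]; linarith
    have h2 := (abs_le.1 hab).2
    exact aux_pow_four _ _ _ _ (norm_nonneg _) (norm_nonneg _) (by linarith) (by linarith) hab
  have hcard : (Fintype.card (DirichletCharacter ℂ q) : ℝ) = F := by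
    rw [← Nat.card_eq_fintype_card, DirichletCharacter.card_eq_totient_of_hasEnoughRootsOfUnity ℂ q]
  have e1 : |∑ χ ∈ Finset.univ.filter (fun χ : DirichletCharacter ℂ q => χ ≠ 1), ‖χ.LFunction 1‖ ^ 4
      - ∑ χ ∈ Finset.univ.filter (fun χ : DirichletCharacter ℂ q => χ ≠ 1), ‖auxS q χ‖ ^ 4| ≤
      F * (1 / q * (4 * (4 * ℓ) ^ 3)) := by
    rw [← Finset.sum_sub_distrib]
    refine (Finset.abs_sum_le_sum_abs _ _).trans ?_
    refine (Finset.sum_le_sum fun χ hχ => hL χ (Finset.mem_filter.1 hχ).2).trans ?_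
    rw [Finset.sum_const, nsmul_eq_mul]
    gcongr
    rw [← hcard]
    exact_mod_cast Finset.card_le_univ _
  have e2 : ∑ χ ∈ Finset.univ.filter (fun χ : DirichletCharacter ℂ q => χ ≠ 1), ‖auxS q χ‖ ^ 4
      = F * (∑ p ∈ auxX q, ∑ r ∈ auxX q, auxW q p r) - ‖auxS q 1‖ ^ 4 := by
    rw [← aux_fourth, Finset.filter_ne', Finset.sum_erase_eq_sub (Finset.mem_univ _)]
  have e3 := aux_rem q hq
  rw [← hM, ← hH, ← hs] at e3
  have e4 : ‖auxS q 1‖ ^ 4 ≤ (3 * ℓ) ^ 4 := by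
    gcongr
    exact (auxS_norm q 1).trans hH3
  have e4' : 0 ≤ ‖auxS q 1‖ ^ 4 := by positivity
  rw [e2] at e1
  set X := ∑ p ∈ auxX q, ∑ r ∈ auxX q, auxW q p r with hX
  set Y := ∑ χ ∈ Finset.univ.filter (fun χ : DirichletCharacter ℂ q => χ ≠ 1), ‖χ.LFunction 1‖ ^ 4 with hY
  have e5 : |X - M| ≤ 4 * ((3 * ℓ) ^ 3 * (1 / s + (2 * ℓ) * (1 / s))) := by
    refine e3.trans ?_
    rw [div_eq_mul_one_div (1 + Real.log q)]
    gcongr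
    linarith
  have e6 : |F * X - F * M| ≤ F * (4 * ((3 * ℓ) ^ 3 * (1 / s + (2 * ℓ) * (1 / s)))) := by
    rw [← mul_sub, abs_mul, abs_of_nonneg hF0]
    gcongr
  have e7 : |Y - (F * X - ‖auxS q 1‖ ^ 4)| ≤ F * (1 / s * (4 * (4 * ℓ) ^ 3)) := by
    refine e1.trans ?_
    gcongr
  have e8 : |Y - F * M| ≤ F * (1 / s * (4 * (4 * ℓ) ^ 3)) + (3 * ℓ) ^ 4 +
      F * (4 * ((3 * ℓ) ^ 3 * (1 / s + (2 * ℓ) * (1 / s)))) := by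
    rw [abs_le] at e6 e7 ⊢
    constructor <;> linarith [e6.1, e6.2, e7.1, e7.2]
  refine e8.trans ?_
  set G := F / s with hG
  have hG0 : 0 ≤ G := by positivity
  have hFG : F * (1 / s) = G := by rw [hG]; ring
  have r1 : F * (1 / s * (4 * (4 * ℓ) ^ 3)) ≤ 256 * (G * ℓ ^ 4) := by
    have : F * (1 / s * (4 * (4 * ℓ) ^ 3)) = 256 * (G * ℓ ^ 3) := by rw [← hFG]; ring
    rw [this]
    have h3 : ℓ ^ 3 ≤ ℓ ^ 4 := pow_le_pow_right₀ hℓ1 (by norm_num)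
    gcongr
  have r2 : (3 * ℓ) ^ 4 ≤ 162 * (G * ℓ ^ 4) := by
    have h4 : 0 ≤ ℓ ^ 4 := by positivity
    nlinarith
  have r3 : F * (4 * ((3 * ℓ) ^ 3 * (1 / s + (2 * ℓ) * (1 / s)))) ≤ 324 * (G * ℓ ^ 4) := by
    have : F * (4 * ((3 * ℓ) ^ 3 * (1 / s + (2 * ℓ) * (1 / s)))) =
      108 * (G * ℓ ^ 3) + 216 * (G * ℓ ^ 4) := by rw [← hFG]; ring
    rw [this]
    have h3 : ℓ ^ 3 ≤ ℓ ^ 4 := pow_le_pow_right₀ hℓ1 (by norm_num)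
    have : G * ℓ ^ 3 ≤ G * ℓ ^ 4 := by gcongr
    linarith
  have r4 : 0 ≤ G * ℓ ^ 4 := by positivity
  linarith
end

section
/- Let ζ₁(s,α) = ζ(s,α) − α^{−s}. For every real s > 0, every real α with 0 ≤ α ≤ 1, and every integer N ≥ 1, one has |ζ₁(s,α) − ∑_{n=0}^{N−1} a_n(s) αⁿ| ≤ (s(s+1)⋯(s+N−1)/N!) · ζ(s+N) · α^N (interpreting ζ₁(s,α) at s with 0 < s ≤ 1, s ≠ 1, via analytic continuation, and at s = 1 replacing ζ₁(s,α) and a₀(s) = ζ(s) by their common regularization ζ₁(s,α) − 1/(s−1) and ζ(s) − 1/(s−1)), where a_n(s) = ((−1)ⁿ/n!) s(s+1)⋯(s+n−1) ζ(s+n) for n ≥ 1. -/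
open HurwitzZeta Filter Topology

/-- Taylor coefficient factor. -/
noncomputable def tcoef (w : ℂ) (k : ℕ) : ℂ :=
  ((-1 : ℂ) ^ k / k.factorial) * (∏ j ∈ Finset.range k, (w + j))

/-- Taylor remainder of `(m+z)^(-w)`. -/
noncomputable def trem (m : ℝ) (N : ℕ) (w z : ℂ) : ℂ :=
  ((m : ℂ) + z) ^ (-w) - ∑ k ∈ Finset.range N, tcoef w k * (m : ℂ) ^ (-(w + k)) * z ^ k

lemma tcoef_succ (w : ℂ) (k : ℕ) : tcoef w (k + 1) * (k + 1) = -w * tcoef (w + 1) k := by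
  unfold tcoef
  rw [Finset.prod_range_succ', Nat.factorial_succ]
  have h1 : (k.factorial : ℂ) ≠ 0 := by exact_mod_cast k.factorial_ne_zero
  have h2 : ((k : ℂ) + 1) ≠ 0 := by exact_mod_cast k.succ_ne_zero
  have h3 : ∏ j ∈ Finset.range k, (w + ((j + 1 : ℕ) : ℂ)) =
      ∏ j ∈ Finset.range k, (w + 1 + (j : ℂ)) := by
    refine Finset.prod_congr rfl fun j _ => ?_
    push_cast; ring
  rw [h3]
  push_cast
  field_simp
  ring

lemma trem_deriv {m : ℝ} (hm : 0 < m) (N : ℕ) (w : ℂ) {x : ℝ} (hx : 0 ≤ x) :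
    HasDerivAt (fun y : ℝ => trem m (N + 1) w y) (-w * trem m N (w + 1) x) x := by
  have h1 : HasDerivAt (fun z : ℂ => ((m : ℂ) + z) ^ (-w))
      (-w * ((m : ℂ) + x) ^ (-w - 1) * 1) (x : ℂ) := by
    apply HasDerivAt.cpow_const
    · exact (hasDerivAt_id _).const_add _
    · left; simp; linarith
  have h2 : HasDerivAt (fun z : ℂ => ∑ k ∈ Finset.range (N + 1),
      tcoef w k * (m : ℂ) ^ (-(w + k)) * z ^ k)
      (∑ k ∈ Finset.range (N + 1),
      tcoef w k * (m : ℂ) ^ (-(w + k)) * (k * (x : ℂ) ^ (k - 1))) (x : ℂ) := by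
    apply HasDerivAt.fun_sum
    intro k _
    exact (hasDerivAt_pow k (x : ℂ)).const_mul _
  have h3 := (h1.sub h2).comp_ofReal
  convert! h3 using 1
  rw [Finset.sum_range_succ']
  unfold trem
  rw [mul_sub, Finset.mul_sum]
  simp only [Nat.cast_zero, zero_mul, mul_zero, add_zero, mul_one, Nat.add_sub_cancel]
  congr 1
  · congr 2; ring
  · refine Finset.sum_congr rfl fun k _ => ?_
    have := tcoef_succ w k
    have e : -(w + ((k + 1 : ℕ) : ℂ)) = -(w + 1 + k) := by push_cast; ring
    rw [e]
    push_cast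
    linear_combination (-(m : ℂ) ^ (-(w + 1 + k)) * (x : ℂ) ^ k) * this

lemma trem_zero (m : ℝ) (N : ℕ) (w : ℂ) : trem m (N + 1) w 0 = 0 := by
  unfold trem
  rw [Finset.sum_range_succ']
  simp [tcoef]

lemma trem_bound {m : ℝ} (hm : 0 < m) (N : ℕ) : ∀ (w : ℂ), 0 ≤ w.re → ∀ x : ℝ, 0 ≤ x →
    ‖trem m N w x‖ ≤ (∏ j ∈ Finset.range N, ‖w + j‖) / N.factorial * m ^ (-(w.re + N)) * x ^ N := by
  induction N with
  | zero =>
    intro w hw x hx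
    simp only [trem, Finset.range_zero, Finset.sum_empty, sub_zero, Finset.prod_empty,
      Nat.factorial_zero, Nat.cast_one, div_one, one_mul, Nat.cast_zero, add_zero, pow_zero, mul_one]
    rw [← Complex.ofReal_add, Complex.norm_cpow_eq_rpow_re_of_pos (by linarith)]
    simp only [Complex.neg_re]
    exact Real.rpow_le_rpow_of_nonpos hm (by linarith) (by linarith)
  | succ N ih =>
    intro w hw x hx
    set C := (∏ j ∈ Finset.range (N + 1), ‖w + j‖) / (N + 1).factorial *
      m ^ (-(w.re + (N + 1 : ℕ))) with hC
    refine image_norm_le_of_norm_deriv_right_le_deriv_boundary (a := 0) (b := x)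
      (f := fun y : ℝ => trem m (N + 1) w y) (f' := fun y => -w * trem m N (w + 1) y)
      (B := fun y => C * y ^ (N + 1)) (B' := fun y => C * ((N + 1 : ℕ) * y ^ N)) ?_ ?_ ?_ ?_ ?_
      (Set.right_mem_Icc.2 hx)
    · intro y hy
      exact (trem_deriv hm N w hy.1).continuousAt.continuousWithinAt
    · intro y hy
      exact (trem_deriv hm N w hy.1).hasDerivWithinAt
    · simp [trem_zero]
    · intro y
      simpa using (hasDerivAt_pow (N + 1) y).const_mul C
    · intro y hy
      have := ih (w + 1) (by simp; linarith) y hy.1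
      rw [norm_mul, norm_neg]
      refine (mul_le_mul_of_nonneg_left this (norm_nonneg w)).trans (le_of_eq ?_)
      rw [hC, Finset.prod_range_succ', Nat.factorial_succ]
      have h3 : ∏ j ∈ Finset.range N, ‖w + ((j + 1 : ℕ) : ℂ)‖ =
          ∏ j ∈ Finset.range N, ‖w + 1 + (j : ℂ)‖ := by
        refine Finset.prod_congr rfl fun j _ => ?_
        congr 1
        push_cast; ring
      rw [h3]
      have e : -((w + 1).re + N) = -(w.re + (N + 1 : ℕ)) := by
        simp; ring
      rw [e]
      have h1 : (N.factorial : ℝ) ≠ 0 := by exact_mod_cast N.factorial_ne_zero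
      have h2 : ((N : ℝ) + 1) ≠ 0 := by exact_mod_cast N.succ_ne_zero
      push_cast
      field_simp
      simp
      ring

lemma hasSum_zeta {w : ℂ} (hw : 1 < w.re) :
    HasSum (fun n : ℕ => (((n + 1 : ℝ)) : ℂ) ^ (-w)) (riemannZeta w) := by
  have h := hasSum_hurwitzZeta_of_one_lt_re (a := 1) (by simp) hw
  have e : ((1 : ℝ) : UnitAddCircle) = 0 := AddCircle.coe_period 1
  rw [e, hurwitzZeta_zero] at h
  convert! h using 2 with n
  rw [Complex.cpow_neg, one_div]
  push_cast; rfl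

lemma hasSum_hurwitz {α : ℝ} (hα0 : 0 ≤ α) (hα1 : α ≤ 1) {w : ℂ} (hw : 1 < w.re) :
    HasSum (fun n : ℕ => (((n + 1 : ℝ)) + α : ℂ) ^ (-w))
      (hurwitzZeta (α : UnitAddCircle) w - (α : ℂ) ^ (-w)) := by
  have h := hasSum_hurwitzZeta_of_one_lt_re (a := α) ⟨hα0, hα1⟩ hw
  rw [← hasSum_nat_add_iff' 1] at h
  convert! h using 2 with n
  · rw [Complex.cpow_neg, one_div]
    push_cast; rfl
  · simp [Complex.cpow_neg]

lemma hasSum_trem {α : ℝ} (hα0 : 0 ≤ α) (hα1 : α ≤ 1) {w : ℂ} (hw : 1 < w.re) (N : ℕ) :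
    HasSum (fun n : ℕ => trem (n + 1) N w α)
      (hurwitzZeta (α : UnitAddCircle) w - (α : ℂ) ^ (-w) -
        ∑ k ∈ Finset.range N, tcoef w k * riemannZeta (w + k) * (α : ℂ) ^ k) := by
  unfold trem
  refine HasSum.sub ?_ ?_
  · simpa using hasSum_hurwitz hα0 hα1 hw
  · apply hasSum_sum
    intro k _
    refine HasSum.mul_right _ (HasSum.mul_left _ ?_)
    apply hasSum_zeta
    simp
    have : (0 : ℝ) ≤ k := k.cast_nonneg
    linarith

lemma summable_aux {t : ℝ} (ht : 1 < t) : Summable (fun n : ℕ => ((n : ℝ) + 1) ^ (-t)) := by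
  refine ((Real.summable_one_div_nat_add_rpow 1 t).2 ht).congr fun n => ?_
  have : (0 : ℝ) ≤ (n : ℝ) + 1 := by positivity
  rw [abs_of_nonneg this, Real.rpow_neg this, one_div]

lemma differentiable_trem {m : ℝ} (hm : 0 < m) {α : ℝ} (hα : 0 ≤ α) (N : ℕ) :
    Differentiable ℂ (fun w => trem m N w α) := by
  unfold trem tcoef
  have h1 : (m : ℂ) ≠ 0 := by exact_mod_cast hm.ne'
  have h2 : (m : ℂ) + α ≠ 0 := by
    rw [← Complex.ofReal_add]; exact_mod_cast (by linarith : 0 < m + α).ne'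
  refine Differentiable.sub ?_ ?_
  · exact Differentiable.const_cpow (by fun_prop) (Or.inl h2)
  · refine Differentiable.fun_sum fun k _ => ?_
    refine Differentiable.mul (Differentiable.mul (by fun_prop) ?_) (by fun_prop)
    exact Differentiable.const_cpow (by fun_prop) (Or.inl h1)

lemma differentiableOn_sum {α : ℝ} (hα : 0 ≤ α) {N : ℕ} (hN : 1 ≤ N) :
    DifferentiableOn ℂ (fun w => ∑' n : ℕ, trem (n + 1) N w α) {w : ℂ | 0 < w.re} := by
  intro w₀ hw₀
  have hw₀' : 0 < w₀.re := hw₀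
  set δ := w₀.re / 2 with hδ
  have hδ0 : 0 < δ := by positivity
  set M := ‖w₀‖ + 1 with hM
  let V : Set ℂ := {w | δ < w.re} ∩ {w | ‖w‖ < M}
  have hV : IsOpen V := (isOpen_lt continuous_const Complex.continuous_re).inter
    (isOpen_lt continuous_norm continuous_const)
  have hmem : w₀ ∈ V := ⟨by simp [hδ]; linarith, by simp [hM]⟩
  have hN' : (1 : ℝ) ≤ N := by exact_mod_cast hN
  have key : DifferentiableOn ℂ (fun w => ∑' n : ℕ, trem (n + 1) N w α) V := by
    refine Complex.differentiableOn_tsum_of_summable_norm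
      (u := fun n : ℕ => (∏ j ∈ Finset.range N, (M + j)) / N.factorial *
        ((n : ℝ) + 1) ^ (-(δ + N)) * α ^ N) ?_ ?_ hV ?_
    · exact ((summable_aux (by linarith)).mul_left _).mul_right _
    · intro n
      exact (differentiable_trem (by positivity) hα N).differentiableOn
    · rintro n w ⟨hw1, hw2⟩
      simp only [Set.mem_ofPred_eq] at hw1 hw2
      refine (trem_bound (by positivity) N w (by linarith) α hα).trans ?_
      have h1 : ∏ j ∈ Finset.range N, ‖w + j‖ ≤ ∏ j ∈ Finset.range N, (M + j) := by
        refine Finset.prod_le_prod (fun _ _ => norm_nonneg _) fun j _ => ?_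
        refine (norm_add_le _ _).trans ?_
        simp; linarith
      have h2 : ((n : ℝ) + 1) ^ (-(w.re + N)) ≤ ((n : ℝ) + 1) ^ (-(δ + N)) :=
        Real.rpow_le_rpow_of_exponent_le (by linarith [(n.cast_nonneg : (0 : ℝ) ≤ n)])
          (by linarith)
      have h3 : 0 ≤ ∏ j ∈ Finset.range N, (M + (j : ℝ)) :=
        Finset.prod_nonneg fun j _ => by positivity
      gcongr
  exact (key.differentiableAt (hV.mem_nhds hmem)).differentiableWithinAt

/-- The left hand side function. -/
noncomputable def lfun (α : ℝ) (N : ℕ) (w : ℂ) : ℂ :=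
  (hurwitzZeta (α : UnitAddCircle) w - hurwitzZeta 0 w) - (α : ℂ) ^ (-w) -
    ∑ k ∈ Finset.Ico 1 N, tcoef w k * riemannZeta (w + k) * (α : ℂ) ^ k

lemma differentiableAt_lfun (α : ℝ) (N : ℕ) {w : ℂ} (hw : 0 < w.re) :
    DifferentiableAt ℂ (lfun α N) w := by
  unfold lfun tcoef
  have hw0 : w ≠ 0 := by rintro rfl; simp at hw
  refine DifferentiableAt.sub (DifferentiableAt.sub
    (differentiable_hurwitzZeta_sub_hurwitzZeta _ _ w) ?_) ?_
  · exact DifferentiableAt.const_cpow (by fun_prop) (Or.inr (neg_ne_zero.2 hw0))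
  · refine DifferentiableAt.fun_sum fun k hk => ?_
    refine DifferentiableAt.mul (DifferentiableAt.mul (by fun_prop) ?_) (by fun_prop)
    have hk1 : (1 : ℝ) ≤ k := by exact_mod_cast (Finset.mem_Ico.1 hk).1
    have h1 : w + k ≠ 1 := by
      intro h
      have := congrArg Complex.re h
      simp at this
      linarith
    exact DifferentiableAt.comp w (differentiableAt_riemannZeta h1) (by fun_prop)

lemma lfun_eq {α : ℝ} (hα0 : 0 ≤ α) (hα1 : α ≤ 1) {N : ℕ} (hN : 1 ≤ N) :
    Set.EqOn (lfun α N) (fun w => ∑' n : ℕ, trem (n + 1) N w α) {w : ℂ | 0 < w.re} := by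
  have ho : IsOpen {w : ℂ | 0 < w.re} := isOpen_lt continuous_const Complex.continuous_re
  have ho1 : IsOpen {w : ℂ | 1 < w.re} := isOpen_lt continuous_const Complex.continuous_re
  refine AnalyticOnNhd.eqOn_of_preconnected_of_eventuallyEq (𝕜 := ℂ) (z₀ := 2) ?_ ?_
    (convex_halfSpace_re_gt 0).isPreconnected (by simp) ?_
  · exact DifferentiableOn.analyticOnNhd
      (fun w hw => (differentiableAt_lfun α N hw).differentiableWithinAt) ho
  · exact (differentiableOn_sum hα0 hN).analyticOnNhd ho
  · filter_upwards [ho1.mem_nhds (by simp : (2 : ℂ) ∈ {w : ℂ | 1 < w.re})] with w hw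
    rw [(hasSum_trem hα0 hα1 hw N).tsum_eq, Finset.sum_range_eq_add_Ico _ hN, lfun,
      hurwitzZeta_zero]
    simp [tcoef]
    ring

lemma lfun_bound {s : ℝ} (hs : 0 < s) {α : ℝ} (hα0 : 0 ≤ α) (hα1 : α ≤ 1) {N : ℕ} (hN : 1 ≤ N) :
    ‖lfun α N s‖ ≤ ((∏ j ∈ Finset.range N, (s + j)) / N.factorial) *
        ‖riemannZeta ((s : ℂ) + N)‖ * α ^ N := by
  have hN' : (1 : ℝ) ≤ N := by exact_mod_cast hN
  rw [lfun_eq hα0 hα1 hN (by simpa using hs : (s : ℂ) ∈ {w : ℂ | 0 < w.re})]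
  have hsum := (summable_aux (t := s + N) (by linarith)).hasSum
  have hz : riemannZeta ((s : ℂ) + N) =
      ((∑' n : ℕ, ((n : ℝ) + 1) ^ (-(s + N)) : ℝ) : ℂ) := by
    refine (hasSum_zeta (w := (s : ℂ) + N) (by simp; linarith)).unique ?_
    convert! Complex.hasSum_ofReal.2 hsum using 2 with n
    rw [Complex.ofReal_cpow (by positivity)]
    push_cast; rfl
  have hnn : 0 ≤ ∑' n : ℕ, ((n : ℝ) + 1) ^ (-(s + N)) := tsum_nonneg fun n => by positivity
  rw [hz, Complex.norm_real, Real.norm_of_nonneg hnn]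
  refine tsum_of_norm_bounded ((hsum.mul_left _).mul_right _) fun n => ?_
  have := trem_bound (m := (n : ℝ) + 1) (by positivity) N (s : ℂ) (by simpa using hs.le) α hα0
  have hp : ∏ j ∈ Finset.range N, ‖(s : ℂ) + j‖ = ∏ j ∈ Finset.range N, (s + j) := by
    refine Finset.prod_congr rfl fun j _ => ?_
    rw [← Complex.ofReal_natCast, ← Complex.ofReal_add, Complex.norm_real, Real.norm_of_nonneg]
    positivity
  rw [hp] at this
  exact this


/-- For every real `s > 0`, every `α ∈ [0,1]` and every integer `N ≥ 1`, with
`ζ₁(s,α) = ζ(s,α) − α^{−s}` and `a_n(s) = ((−1)ⁿ/n!) s(s+1)⋯(s+n−1) ζ(s+n)`,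
one has `|ζ₁(s,α) − ∑_{n=0}^{N−1} a_n(s) αⁿ| ≤ (s(s+1)⋯(s+N−1)/N!) ζ(s+N) α^N`.
Here `Z` stands for (the analytic continuation of) `ζ₁(s,α)` and `A` for `a₀(s) = ζ(s)`;
at `s = 1` they are replaced by the common regularizations
`lim (ζ₁(s,α) − 1/(s−1))` and `lim (ζ(s) − 1/(s−1))`. -/
theorem hurwitzZeta_taylor_remainder_bound {s : ℝ} (hs : 0 < s)
    {α : ℝ} (hα0 : 0 ≤ α) (hα1 : α ≤ 1) {N : ℕ} (hN : 1 ≤ N) (Z A : ℂ)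
    (hreg : (s ≠ 1 →
        Z = hurwitzZeta (α : UnitAddCircle) (s : ℂ) - (α : ℂ) ^ (-(s : ℂ)) ∧
        A = riemannZeta (s : ℂ)) ∧
      (s = 1 →
        Tendsto (fun w : ℂ => hurwitzZeta (α : UnitAddCircle) w - (α : ℂ) ^ (-w) - 1 / (w - 1))
          (𝓝[≠] 1) (𝓝 Z) ∧
        Tendsto (fun w : ℂ => riemannZeta w - 1 / (w - 1)) (𝓝[≠] 1) (𝓝 A))) :
    ‖Z - (A + ∑ n ∈ Finset.Ico 1 N,
        ((-1 : ℂ) ^ n / n.factorial) * (∏ j ∈ Finset.range n, ((s : ℂ) + j)) *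
          riemannZeta ((s : ℂ) + n) * (α : ℂ) ^ n)‖ ≤
      ((∏ j ∈ Finset.range N, (s + j)) / N.factorial) *
        ‖riemannZeta ((s : ℂ) + N)‖ * α ^ N := by
  have hb := lfun_bound hs hα0 hα1 hN
  suffices h : Z - A = (hurwitzZeta (α : UnitAddCircle) s - hurwitzZeta 0 s) - (α : ℂ) ^ (-(s : ℂ)) by
    rw [← sub_sub, h]
    exact hb
  by_cases h1 : s = 1
  · obtain ⟨hZ, hA⟩ := hreg.2 h1
    have ht := hZ.sub hA
    have hd := (differentiableAt_lfun α 1 (w := 1) (by simp)).continuousAt.tendsto.mono_left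
      (nhdsWithin_le_nhds (s := {1}ᶜ))
    have := tendsto_nhds_unique (ht.congr fun w => ?_) hd
    · rw [this, h1]
      simp [lfun]
    · simp [lfun, hurwitzZeta_zero]
      ring
  · obtain ⟨hZ, hA⟩ := hreg.1 h1
    rw [hZ, hA, hurwitzZeta_zero]
    ring
end
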